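/- Let k be a field and R = k[t] the polynomial ring in one variable. The Nagata map N = (X + t(tY + X²), Y − 2X(tY + X²) − t(tY + X²)²) induces an R-algebra automorphism of R[X, Y], and this automorphism does not belong to Tame₂(R). -/

import Mathlib

noncomputable section

/-- `σ` is an affine automorphism of `S[X₁,…,Xₙ]`:
`Xᵢ ↦ Σⱼ aᵢⱼ Xⱼ + bᵢ` with `(aᵢⱼ) ∈ GLₙ(S)` and `bᵢ ∈ S`. -/
def IsAffineAut {S : Type*} [CommRing S] {n : ℕ}
    (σ : MvPolynomial (Fin n) S ≃ₐ[S] MvPolynomial (Fin n) S) : Prop :=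
  ∃ M : Matrix (Fin n) (Fin n) S, IsUnit M.det ∧ ∃ b : Fin n → S,
    ∀ i, σ (MvPolynomial.X i) =
      (∑ j, MvPolynomial.C (M i j) * MvPolynomial.X j) + MvPolynomial.C (b i)

/-- `σ` is an elementary automorphism of `S[X₁,…,Xₙ]`: it sends one variable `Xᵢ` to
`Xᵢ + f` where `f` is a polynomial in the remaining variables, and fixes the others. -/
def IsElementaryAut {S : Type*} [CommRing S] {n : ℕ}
    (σ : MvPolynomial (Fin n) S ≃ₐ[S] MvPolynomial (Fin n) S) : Prop :=
  ∃ (i : Fin n) (f : MvPolynomial (Fin n) S),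
    f ∈ MvPolynomial.supported S {j | j ≠ i} ∧
    σ (MvPolynomial.X i) = MvPolynomial.X i + f ∧
    ∀ j, j ≠ i → σ (MvPolynomial.X j) = MvPolynomial.X j

/-- The tame subgroup `Tameₙ(S)` of the group of `S`-algebra automorphisms of
`S[X₁,…,Xₙ]`, generated by the affine and the elementary automorphisms. -/
def TameSubgroup (S : Type*) [CommRing S] (n : ℕ) :
    Subgroup (MvPolynomial (Fin n) S ≃ₐ[S] MvPolynomial (Fin n) S) :=
  Subgroup.closure {σ | IsAffineAut σ ∨ IsElementaryAut σ}

/-- `SL_m(S[X₁,…,Xₙ]) = E_m(S[X₁,…,Xₙ])` for all `n, m ≥ 0`: every matrix of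
determinant one over every polynomial ring over `S` is a product of elementary
matrices (transvections). -/
def SLeqE (S : Type*) [CommRing S] : Prop :=
  ∀ (n m : ℕ) (M : Matrix.SpecialLinearGroup (Fin m) (MvPolynomial (Fin n) S)),
    M ∈ Subgroup.closure {A : Matrix.SpecialLinearGroup (Fin m) (MvPolynomial (Fin n) S) |
      ∃ (i j : Fin m) (c : MvPolynomial (Fin n) S), i ≠ j ∧
        (A : Matrix (Fin m) (Fin m) (MvPolynomial (Fin n) S)) = Matrix.transvection i j c}

/-- First coordinate of the Nagata map over `R = k[t]`: `X + t(tY + X²)`. -/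
def nagataP (k : Type*) [Field k] : MvPolynomial (Fin 2) (Polynomial k) :=
  let T : MvPolynomial (Fin 2) (Polynomial k) := MvPolynomial.C Polynomial.X
  let x : MvPolynomial (Fin 2) (Polynomial k) := MvPolynomial.X 0
  let y : MvPolynomial (Fin 2) (Polynomial k) := MvPolynomial.X 1
  x + T * (T * y + x ^ 2)

/-- Second coordinate of the Nagata map over `R = k[t]`:
`Y − 2X(tY + X²) − t(tY + X²)²`. -/
def nagataQ (k : Type*) [Field k] : MvPolynomial (Fin 2) (Polynomial k) :=
  let T : MvPolynomial (Fin 2) (Polynomial k) := MvPolynomial.C Polynomial.X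
  let x : MvPolynomial (Fin 2) (Polynomial k) := MvPolynomial.X 0
  let y : MvPolynomial (Fin 2) (Polynomial k) := MvPolynomial.X 1
  y - 2 * x * (T * y + x ^ 2) - T * (T * y + x ^ 2) ^ 2

section AutInverses

open MvPolynomial

variable {S : Type*} [CommRing S] {n : ℕ} {σ : MvPolynomial (Fin n) S ≃ₐ[S] MvPolynomial (Fin n) S}

theorem IsAffineAut.inv (h : IsAffineAut σ) : IsAffineAut σ⁻¹ := by
  obtain ⟨M, hM, b, hσ⟩ := h
  refine ⟨M⁻¹, (Matrix.isUnit_nonsing_inv_det_iff).2 hM, -(M⁻¹.mulVec b), fun i => ?_⟩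
  apply σ.injective
  have hMM : M⁻¹ * M = 1 := Matrix.nonsing_inv_mul M hM
  have hentry : ∀ l, ∑ j, M⁻¹ i j * M j l = (1 : Matrix (Fin n) (Fin n) S) i l := fun l => by
    rw [← hMM, Matrix.mul_apply]
  have hsum : ∑ j, (C (M⁻¹ i j) * ∑ l, C (M j l) * X l : MvPolynomial (Fin n) S) = X i := by
    simp_rw [Finset.mul_sum]
    rw [Finset.sum_comm]
    simp_rw [← mul_assoc, ← C_mul, ← Finset.sum_mul, ← map_sum, hentry, Matrix.one_apply]
    simp
  have hC : ∀ a, σ (C a) = C a := fun a => σ.commutes a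
  rw [show σ (σ⁻¹ (X i)) = X i from σ.apply_symm_apply _]
  simp only [map_add, map_sum, map_mul, hC, hσ, mul_add, Finset.sum_add_distrib, hsum]
  simp [Matrix.mulVec, dotProduct]

theorem IsElementaryAut.inv (h : IsElementaryAut σ) : IsElementaryAut σ⁻¹ := by
  obtain ⟨i, f, hf, hi, hj⟩ := h
  have hfix : σ f = f := by
    have hle : supported S {j | j ≠ i} ≤ AlgHom.equalizer σ.toAlgHom (AlgHom.id S _) := by
      rw [supported, Algebra.adjoin_le_iff]
      rintro _ ⟨j, hji, rfl⟩
      exact hj j hji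
    exact hle hf
  refine ⟨i, -f, neg_mem hf, ?_, fun j hji => ?_⟩ <;> apply σ.injective
  · rw [show σ (σ⁻¹ (X i)) = X i from σ.apply_symm_apply _, map_add, map_neg, hi, hfix]
    ring
  · rw [show σ (σ⁻¹ (X j)) = X j from σ.apply_symm_apply _, hj j hji]

end AutInverses

section DegreeReduction

open Polynomial

variable {R : Type*} [CommRing R]

/-- Pairs built from the generic line `(Z, uZ)` in `R[u][Z]` by invertible affine substitutions
and by shears `(p, q) ↦ (p + f(q), q)` that raise the degree. -/
inductive ReducedPair : R[X][X] → R[X][X] → Prop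
  | base : ReducedPair X (C X * X)
  | affine {p q : R[X][X]} (a b c d e f : R) (h : IsUnit (a * d - b * c))
      (hpq : ReducedPair p q) :
      ReducedPair (C (C a) * p + C (C b) * q + C (C e)) (C (C c) * p + C (C d) * q + C (C f))
  | shear {p q : R[X][X]} (f : R[X]) (hf : 2 ≤ f.natDegree) (hle : p.natDegree ≤ q.natDegree)
      (hpq : ReducedPair p q) : ReducedPair (p + aeval q f) q

theorem aeval_eq_map_comp (q : R[X][X]) (f : R[X]) : aeval q f = (f.map C).comp q := by
  rw [comp, eval₂_map, aeval_def]
  rfl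

theorem ReducedPair.shear_of_natDegree_le {p q : R[X][X]} (hpq : ReducedPair p q)
    (hle : p.natDegree ≤ q.natDegree) (f : R[X]) : ReducedPair (p + aeval q f) q := by
  rcases le_or_gt 2 f.natDegree with hf | hf
  · exact hpq.shear f hf hle
  · have h := hpq.affine 1 (f.coeff 1) 0 1 (f.coeff 0) 0 (by simp)
    have hfe := eq_X_add_C_of_natDegree_le_one (p := f) (by omega)
    convert h using 1
    · conv_lhs => rw [hfe]
      simp [add_assoc, Polynomial.algebraMap_apply]
    · simp

theorem combination_combination (p q : R[X][X]) (a b c d e f x y z : R) :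
    C (C x) * (C (C a) * p + C (C b) * q + C (C e)) +
      C (C y) * (C (C c) * p + C (C d) * q + C (C f)) + C (C z) =
    C (C (x * a + y * c)) * p + C (C (x * b + y * d)) * q + C (C (x * e + y * f + z)) := by
  simp only [map_add, map_mul]
  ring

theorem natDegree_combination_le {p q : R[X][X]} {D : ℕ} (hp : p.natDegree ≤ D)
    (hq : q.natDegree ≤ D) (a b e : R) :
    (C (C a) * p + C (C b) * q + C (C e)).natDegree ≤ D := by
  refine natDegree_add_le_of_degree_le (natDegree_add_le_of_degree_le ?_ ?_) (by simp)
  · exact (natDegree_C_mul_le _ _).trans hp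
  · exact (natDegree_C_mul_le _ _).trans hq

theorem natDegree_combination_base (a b e : R) (h : a ≠ 0 ∨ b ≠ 0) :
    (C (C a) * X + C (C b) * (C X * X) + C (C e) : R[X][X]).natDegree = 1 := by
  have h0 : C a + C b * X ≠ 0 := by
    intro h0
    have h1 := congrArg (coeff · 0) h0
    have h2 := congrArg (coeff · 1) h0
    simp at h1 h2
    tauto
  rw [← natDegree_linear (b := C e) h0]
  congr 1
  simp only [map_add, map_mul]
  ring

theorem exists_eq_aeval_of_mem_supported_singleton {ι : Type*} {j : ι} {f : MvPolynomial ι R}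
    (hf : f ∈ MvPolynomial.supported R {j}) : ∃ g : R[X], f = aeval (MvPolynomial.X j) g := by
  rw [MvPolynomial.supported, Set.image_singleton, Algebra.adjoin_singleton_eq_range_aeval] at hf
  obtain ⟨g, hg⟩ := hf
  exact ⟨g, hg.symm⟩

theorem ReducedPair.swap {p q : R[X][X]} (h : ReducedPair p q) : ReducedPair q p := by
  simpa using h.affine 0 1 1 0 0 0 (by simp)

variable [IsDomain R]

theorem natDegree_aeval_eq (q : R[X][X]) (f : R[X]) :
    (aeval q f).natDegree = f.natDegree * q.natDegree := by
  rw [aeval_eq_map_comp, natDegree_comp, natDegree_map_eq_of_injective C_injective]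

theorem natDegree_add_aeval_eq {p q : R[X][X]} (hle : p.natDegree ≤ q.natDegree)
    (hq : 1 ≤ q.natDegree) {f : R[X]} (hf : 2 ≤ f.natDegree) :
    (p + aeval q f).natDegree = f.natDegree * q.natDegree := by
  rw [natDegree_add_eq_right_of_natDegree_lt, natDegree_aeval_eq]
  rw [natDegree_aeval_eq]
  nlinarith

theorem natDegree_lt_natDegree_add_aeval {p q : R[X][X]} (hle : p.natDegree ≤ q.natDegree)
    (hq : 1 ≤ q.natDegree) {f : R[X]} (hf : 2 ≤ f.natDegree) :
    q.natDegree < (p + aeval q f).natDegree := by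
  rw [natDegree_add_aeval_eq hle hq hf]
  nlinarith

theorem natDegree_combination_eq {p q : R[X][X]} (hlt : q.natDegree < p.natDegree)
    {a : R} (ha : a ≠ 0) (b e : R) :
    (C (C a) * p + C (C b) * q + C (C e)).natDegree = p.natDegree := by
  have hap : (C (C a) * p).natDegree = p.natDegree :=
    natDegree_C_mul (by simpa using ha)
  rw [natDegree_add_C, natDegree_add_eq_left_of_natDegree_lt, hap]
  rw [hap]
  exact (natDegree_C_mul_le _ _).trans_lt hlt

theorem ReducedPair.one_le_natDegree_combination {p q : R[X][X]} (hpq : ReducedPair p q) :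
    ∀ c d : R, c ≠ 0 ∨ d ≠ 0 → 1 ≤ (C (C c) * p + C (C d) * q).natDegree := by
  induction hpq with
  | base =>
    intro c d h
    simpa using (natDegree_combination_base c d 0 h).ge
  | @affine p q a b c d e f h _ ih =>
    intro x y hxy
    have key : x * a + y * c ≠ 0 ∨ x * b + y * d ≠ 0 := by
      by_contra! h0
      obtain ⟨h1, h2⟩ := h0
      have hx : x * (a * d - b * c) = 0 := by linear_combination d * h1 - c * h2
      have hy : y * (a * d - b * c) = 0 := by linear_combination a * h2 - b * h1
      rw [h.mul_left_eq_zero] at hx hy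
      tauto
    have := ih _ _ key
    rw [← natDegree_add_C (a := C (x * e + y * f))] at this
    convert this using 2
    simp only [map_add, map_mul]
    ring
  | @shear p q f hf hle _ ih =>
    intro c d h
    have hq : 1 ≤ q.natDegree := by simpa using ih 0 1 (by simp)
    by_cases hc : c = 0
    · subst hc
      simpa using ih 0 d (by simpa using h)
    · have hlt := natDegree_lt_natDegree_add_aeval hle hq hf
      have := natDegree_combination_eq hlt hc d 0
      simp only [map_zero, add_zero] at this
      omega

theorem ReducedPair.one_le_natDegree_right {p q : R[X][X]} (hpq : ReducedPair p q) :
    1 ≤ q.natDegree := by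
  simpa using hpq.one_le_natDegree_combination 0 1 (by simp)

theorem ReducedPair.add_aeval {p q : R[X][X]} (hpq : ReducedPair p q) :
    ∀ g : R[X], ReducedPair (p + aeval q g) q := by
  suffices H : ∀ (a b c d e f : R), IsUnit (a * d - b * c) → ∀ g : R[X],
      ReducedPair
        (C (C a) * p + C (C b) * q + C (C e) + aeval (C (C c) * p + C (C d) * q + C (C f)) g)
        (C (C c) * p + C (C d) * q + C (C f)) by
    intro g
    simpa using H 1 0 0 1 0 0 (by simp) g
  induction hpq with
  | base =>
    intro a b c d e f h g
    refine (ReducedPair.base.affine a b c d e f h).shear_of_natDegree_le ?_ g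
    rw [natDegree_combination_base c d f]
    · exact natDegree_combination_le natDegree_X_le
        ((natDegree_C_mul_le _ _).trans natDegree_X_le) _ _ _
    · by_contra! h0
      simp [h0] at h
  | @affine p q a b c d e f h _ ih =>
    intro a' b' c' d' e' f' h' g
    simp only [combination_combination]
    exact ih _ _ _ _ _ _ (by convert h'.mul h using 1; ring) g
  | @shear p q s hs hle hpq ih =>
    intro a b c d e f h g
    have hlt := natDegree_lt_natDegree_add_aeval hle hpq.one_le_natDegree_right hs
    by_cases hc : c = 0
    · subst hc
      have hau : IsUnit a := isUnit_of_mul_isUnit_left (by simpa using h)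
      obtain ⟨v, hv⟩ := hau.exists_right_inv
      have key := (hpq.shear_of_natDegree_le hle
        (s + C v * (C b * X + C e + g.comp (C d * X + C f)))).affine a 0 0 d 0 f (by simpa using h)
      have hv' : (C (C a) * C (C v) : R[X][X]) = 1 := by rw [← C_mul, ← C_mul, hv]; simp
      convert key using 1
      · simp only [map_add, map_mul, aeval_C, aeval_X, aeval_comp, Polynomial.algebraMap_apply,
          map_zero, zero_mul, zero_add, Algebra.algebraMap_self, RingHom.id_apply]
        linear_combination (-(C (C b) * q + C (C e) + aeval (C (C d) * q + C (C f)) g)) * hv'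
      · simp
    · refine ((hpq.shear s hs hle).affine a b c d e f h).shear_of_natDegree_le ?_ g
      rw [natDegree_combination_eq hlt hc]
      exact natDegree_combination_le le_rfl hlt.le _ _ _

theorem ReducedPair.exists_natDegree_sub_aeval_le {p q : R[X][X]} (hpq : ReducedPair p q)
    (hlt : p.natDegree < q.natDegree) :
    ∃ g : R[X], (q - aeval p g).natDegree ≤ p.natDegree := by
  suffices H : ∀ (a b c d e f : R), IsUnit (a * d - b * c) →
      (C (C a) * p + C (C b) * q + C (C e)).natDegree <
        (C (C c) * p + C (C d) * q + C (C f)).natDegree →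
      ∃ g : R[X], (C (C c) * p + C (C d) * q + C (C f) -
        aeval (C (C a) * p + C (C b) * q + C (C e)) g).natDegree ≤
          (C (C a) * p + C (C b) * q + C (C e)).natDegree by
    simpa using H 1 0 0 1 0 0 (by simp) (by simpa using hlt)
  clear hlt
  induction hpq with
  | base =>
    intro a b c d e f h hlt
    rw [natDegree_combination_base, natDegree_combination_base] at hlt
    · omega
    all_goals
      by_contra! h0
      simp [h0] at h
  | @affine p q a b c d e f h _ ih =>
    intro a' b' c' d' e' f' h' hlt
    simp only [combination_combination] at hlt ⊢
    exact ih _ _ _ _ _ _ (by convert h'.mul h using 1; ring) hlt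
  | @shear p q s hs hle hpq ih =>
    intro a b c d e f h hlt'
    have hlt := natDegree_lt_natDegree_add_aeval hle hpq.one_le_natDegree_right hs
    by_cases ha : a = 0
    · subst ha
      have hb : IsUnit b := by
        refine isUnit_of_mul_isUnit_left (y := c) ?_
        simpa using h
      obtain ⟨v, hv⟩ := hb.exists_right_inv
      have hv' : (C (C v) * C (C b) : R[X][X]) = 1 := by
        rw [← C_mul, ← C_mul, mul_comm, hv]; simp
      refine ⟨(C c * s + C d * X).comp (C v * (X - C e)), ?_⟩
      have hq : C (C v) * (C (C b) * q + C (C e) - C (C e)) = q := by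
        linear_combination q * hv'
      have hdeg : (C (C b) * q + C (C e)).natDegree = q.natDegree := by
        rw [natDegree_add_C, natDegree_C_mul]
        simpa using hb.ne_zero
      simp only [map_add, map_mul, map_sub, aeval_C, aeval_X, aeval_comp,
        Polynomial.algebraMap_apply, map_zero, zero_mul, zero_add, Algebra.algebraMap_self,
        RingHom.id_apply, hq, hdeg]
      convert natDegree_combination_le hle le_rfl c 0 f using 2
      simp only [map_zero]
      ring
    · rw [natDegree_combination_eq hlt ha] at hlt'
      exact absurd (natDegree_combination_le le_rfl hlt.le c d f) hlt'.not_ge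

/-- The restriction of polynomials in two variables to the generic line `(Z, uZ)`. -/
def genericLine (R : Type*) [CommRing R] : MvPolynomial (Fin 2) R →ₐ[R] R[X][X] :=
  MvPolynomial.aeval ![X, C X * X]

theorem reducedPair_genericLine_of_mem_tameSubgroup
    {σ : MvPolynomial (Fin 2) R ≃ₐ[R] MvPolynomial (Fin 2) R} (hσ : σ ∈ TameSubgroup R 2) :
    ReducedPair (genericLine R (σ (MvPolynomial.X 0))) (genericLine R (σ (MvPolynomial.X 1))) := by
  have step : ∀ σ τ : MvPolynomial (Fin 2) R ≃ₐ[R] MvPolynomial (Fin 2) R,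
      ReducedPair (genericLine R (σ (MvPolynomial.X 0))) (genericLine R (σ (MvPolynomial.X 1))) →
      IsAffineAut τ ∨ IsElementaryAut τ →
      ReducedPair (genericLine R ((σ * τ) (MvPolynomial.X 0)))
        (genericLine R ((σ * τ) (MvPolynomial.X 1))) := by
    intro σ τ h hτ
    have hC : ∀ a, genericLine R (σ (MvPolynomial.C a)) = C (C a) := fun a => by
      rw [← MvPolynomial.algebraMap_eq, AlgEquiv.commutes, AlgHom.commutes]
      rfl
    have haeval : ∀ (i : Fin 2) (g : R[X]), genericLine R (σ (aeval (MvPolynomial.X i) g)) =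
        aeval (genericLine R (σ (MvPolynomial.X i))) g := fun i g =>
      (aeval_algHom_apply ((genericLine R).comp σ.toAlgHom) _ g).symm
    simp only [AlgEquiv.mul_apply]
    rcases hτ with ⟨M, hM, b, hb⟩ | ⟨i, f, hf, hi, hj⟩
    · rw [Matrix.det_fin_two] at hM
      simpa only [hb, Fin.sum_univ_two, map_add, map_mul, hC] using
        h.affine (M 0 0) (M 0 1) (M 1 0) (M 1 1) (b 0) (b 1) hM
    · fin_cases i
      · rw [show {j : Fin 2 | j ≠ ⟨0, by simp⟩} = {1} by ext j; fin_cases j <;> simp] at hf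
        obtain ⟨g, rfl⟩ := exists_eq_aeval_of_mem_supported_singleton hf
        simp only [Fin.zero_eta] at hi hj
        rw [hi, hj 1 (by simp), map_add, map_add, haeval]
        exact h.add_aeval g
      · rw [show {j : Fin 2 | j ≠ ⟨1, by simp⟩} = {0} by ext j; fin_cases j <;> simp] at hf
        obtain ⟨g, rfl⟩ := exists_eq_aeval_of_mem_supported_singleton hf
        simp only [Fin.mk_one] at hi hj
        rw [hi, hj 0 (by simp), map_add, map_add, haeval]
        exact (h.swap.add_aeval g).swap
  induction hσ using Subgroup.closure_induction_right with
  | one => simpa [genericLine] using ReducedPair.base (R := R)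
  | mul_right σ _ τ hτ ih => exact step σ τ ih hτ
  | mul_inv_cancel σ _ τ hτ ih =>
    exact step σ τ⁻¹ ih (hτ.imp IsAffineAut.inv IsElementaryAut.inv)

end DegreeReduction

section Nagata

variable (k : Type*) [Field k]

/-- The Nagata automorphism of `k[t][X, Y]`. -/
def nagataAut : MvPolynomial (Fin 2) (Polynomial k) ≃ₐ[Polynomial k]
    MvPolynomial (Fin 2) (Polynomial k) :=
  AlgEquiv.ofAlgHom (MvPolynomial.aeval ![nagataP k, nagataQ k])
    (MvPolynomial.aeval
      ![MvPolynomial.X 0 - MvPolynomial.C Polynomial.X *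
          (MvPolynomial.C Polynomial.X * MvPolynomial.X 1 + MvPolynomial.X 0 ^ 2),
        MvPolynomial.X 1 + 2 * MvPolynomial.X 0 *
          (MvPolynomial.C Polynomial.X * MvPolynomial.X 1 + MvPolynomial.X 0 ^ 2) -
          MvPolynomial.C Polynomial.X *
            (MvPolynomial.C Polynomial.X * MvPolynomial.X 1 + MvPolynomial.X 0 ^ 2) ^ 2])
    (by
      ext i : 1
      fin_cases i <;> simp [nagataP, nagataQ, MvPolynomial.algebraMap_eq, two_mul] <;> ring)
    (by
      ext i : 1
      fin_cases i <;> simp [nagataP, nagataQ, MvPolynomial.algebraMap_eq, two_mul] <;> ring)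

open Polynomial

theorem genericLine_nagataP : genericLine k[X] (nagataP k) =
    C (C X) * X ^ 2 + C (1 + C X ^ 2 * X) * X + C 0 := by
  simp [genericLine, nagataP, Polynomial.algebraMap_apply]
  ring

theorem genericLine_nagataQ : genericLine k[X] (nagataQ k) =
    C (-(C X : k[X][X])) * X ^ 4 + (C ((-2 : k[X][X]) * (1 + C X ^ 2 * X)) * X ^ 3 +
      C ((-2 : k[X][X]) * C X * X - C X ^ 3 * X ^ 2) * X ^ 2 + C X * X + C 0) := by
  simp [genericLine, nagataQ, Polynomial.algebraMap_apply, two_mul,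
    show (C 2 : k[X][X][X]) = 2 from rfl]
  ring

theorem not_reducedPair_nagata :
    ¬ ReducedPair (genericLine k[X] (nagataP k)) (genericLine k[X] (nagataQ k)) := by
  intro h
  have hX : (C X : k[X][X]) ≠ 0 := by simp
  have hp : (genericLine k[X] (nagataP k)).natDegree = 2 := by
    rw [genericLine_nagataP]
    exact natDegree_quadratic hX
  have hlow := natDegree_cubic_le (a := ((-2 : k[X][X]) * (1 + C X ^ 2 * X) : k[X][X]))
    (b := (-2 : k[X][X]) * C X * X - C X ^ 3 * X ^ 2) (c := X) (d := 0)
  have htop : (C (-(C X : k[X][X])) * X ^ 4).natDegree = 4 :=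
    natDegree_C_mul_X_pow 4 _ (neg_ne_zero.2 hX)
  have hq : (genericLine k[X] (nagataQ k)).natDegree = 4 := by
    rw [genericLine_nagataQ, natDegree_add_eq_left_of_natDegree_lt, htop]
    omega
  have hqc : (genericLine k[X] (nagataQ k)).coeff 4 = -(C X : k[X][X]) := by
    rw [genericLine_nagataQ, coeff_add,
      coeff_eq_zero_of_natDegree_lt (hlow.trans_lt (by norm_num : 3 < 4)), coeff_C_mul_X_pow]
    simp
  have hpl : (genericLine k[X] (nagataP k)).leadingCoeff = C X := by
    rw [genericLine_nagataP]
    exact leadingCoeff_quadratic hX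
  obtain ⟨g, hg⟩ := h.exists_natDegree_sub_aeval_le (by omega)
  rw [hp] at hg
  have hgp : (aeval (genericLine k[X] (nagataP k)) g).natDegree = 4 := by
    rw [← sub_sub_cancel (genericLine k[X] (nagataQ k)) (aeval _ g),
      natDegree_sub_eq_left_of_natDegree_lt (by omega), hq]
  have hcoeff : (aeval (genericLine k[X] (nagataP k)) g).leadingCoeff = -(C X : k[X][X]) := by
    have h4 := coeff_eq_zero_of_natDegree_lt (hg.trans_lt (by norm_num : 2 < 4))
    rw [coeff_sub, hqc, sub_eq_zero] at h4
    rw [leadingCoeff, hgp, ← h4]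
  have hdeg : g.natDegree = 2 := by
    rw [natDegree_aeval_eq, hp] at hgp
    omega
  rw [aeval_eq_map_comp, leadingCoeff_comp (by omega), hpl,
    natDegree_map_eq_of_injective C_injective, hdeg,
    leadingCoeff_map_of_injective C_injective, ← C_pow, ← C_mul, ← C_neg] at hcoeff
  have h1 := congrArg (coeff · 1) (C_injective hcoeff)
  simp [pow_two, ← mul_assoc] at h1

end Nagata

/-- Let `k` be a field and `R = k[t]`. The Nagata map
`N = (X + t(tY + X²), Y − 2X(tY + X²) − t(tY + X²)²)` induces an `R`-algebra
automorphism of `R[X,Y]`, which does not belong to `Tame₂(R)`. -/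
theorem stmt_15 (k : Type*) [Field k] :
    ∃ σ : MvPolynomial (Fin 2) (Polynomial k) ≃ₐ[Polynomial k]
        MvPolynomial (Fin 2) (Polynomial k),
      σ (MvPolynomial.X 0) = nagataP k ∧
      σ (MvPolynomial.X 1) = nagataQ k ∧
      σ ∉ TameSubgroup (Polynomial k) 2 := by
  refine ⟨nagataAut k, ?_, ?_, fun h => not_reducedPair_nagata k ?_⟩
  · simp [nagataAut]
  · simp [nagataAut]
  · simpa [nagataAut] using reducedPair_genericLine_of_mem_tameSubgroup h

end
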